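/- arXiv:2409.15534 — 2 statements merged into one kernel-verified Lean document; each statement's English description precedes it below -/
import Mathlib

section
/- Let H be a complex Hilbert space and A₀ : H → H a bounded self-adjoint complex-linear operator that is bijective. Suppose ξ : ℝ → H is differentiable and satisfies the ODE ξ'(t) = −A₀(ξ(t)) for all t ∈ ℝ, and suppose ξ is square-integrable on ℝ (i.e. t ↦ ‖ξ(t)‖² has finite Lebesgue integral). Then ξ(t) = 0 for all t. -/
open MeasureTheory

/-- Let `H` be a complex Hilbert space and `A₀` a bounded self-adjoint bijective
operator on `H`.  If `ξ : ℝ → H` is differentiable, solves `ξ' = -A₀ ξ` on all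
of `ℝ`, and `t ↦ ‖ξ t‖²` is Lebesgue-integrable, then `ξ` vanishes identically. -/
theorem ode_solution_vanishes_of_square_integrable
    {H : Type*} [NormedAddCommGroup H] [InnerProductSpace ℂ H] [CompleteSpace H]
    (A₀ : H →L[ℂ] H) (hsa : IsSelfAdjoint A₀) (hbij : Function.Bijective A₀)
    (ξ : ℝ → H)
    (hderiv : ∀ t : ℝ, HasDerivAt ξ (-(A₀ (ξ t))) t)
    (hint : Integrable (fun t : ℝ => ‖ξ t‖ ^ 2)) :
    ∀ t : ℝ, ξ t = 0 := by
  intro t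
  have key : ∀ s : ℝ, inner ℂ (ξ (t + s)) (ξ (t - s)) = inner ℂ (ξ t) (ξ t) := by
    have hd : ∀ s : ℝ, HasDerivAt (fun s : ℝ => inner ℂ (ξ (t + s)) (ξ (t - s))) 0 s := by
      intro s
      have h1 : HasDerivAt (fun s : ℝ => ξ (t + s)) (-(A₀ (ξ (t + s)))) s :=
        (hderiv (t + s)).comp_const_add t s
      have h2 : HasDerivAt (fun s : ℝ => ξ (t - s)) (-(-(A₀ (ξ (t - s))))) s :=
        (hderiv (t - s)).comp_const_sub t s
      have h3 := h1.inner ℂ h2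
      have h4 : inner ℂ (A₀ (ξ (t + s))) (ξ (t - s)) = inner ℂ (ξ (t + s)) (A₀ (ξ (t - s))) :=
        hsa.isSymmetric _ _
      rw [neg_neg, inner_neg_left, h4, add_neg_cancel] at h3
      exact h3
    intro s
    have := is_const_of_deriv_eq_zero (fun s => (hd s).differentiableAt)
      (fun s => (hd s).deriv) s 0
    simpa using this
  have hle : ∀ s : ℝ, ‖ξ t‖ ^ 2 ≤ ‖ξ (t + s)‖ ^ 2 + ‖ξ (t - s)‖ ^ 2 := by
    intro s
    have h1 := norm_inner_le_norm (𝕜 := ℂ) (ξ (t + s)) (ξ (t - s))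
    rw [key s, inner_self_eq_norm_sq_to_K] at h1
    simp at h1
    nlinarith [sq_nonneg (‖ξ (t + s)‖ - ‖ξ (t - s)‖), sq_nonneg ‖ξ (t + s)‖,
      sq_nonneg ‖ξ (t - s)‖]
  have hi : Integrable (fun s : ℝ => ‖ξ (t + s)‖ ^ 2 + ‖ξ (t - s)‖ ^ 2) :=
    (hint.comp_add_left t).add (hint.comp_sub_left t)
  have hc : Integrable (fun _ : ℝ => ‖ξ t‖ ^ 2) := by
    refine hi.mono' aestronglyMeasurable_const (Filter.Eventually.of_forall fun s => ?_)
    rw [Real.norm_of_nonneg (sq_nonneg _)]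
    exact hle s
  rw [integrable_const_iff] at hc
  rcases hc with h | h
  · simpa using h
  · have := h.measure_univ_lt_top
    simp at this
end

section
/- Let u : ℝ → ℝ be a differentiable function satisfying u'(t) = arctan(t) · u(t) for all t ∈ ℝ, and suppose u is square-integrable on ℝ with respect to Lebesgue measure (t ↦ u(t)² is integrable). Then u is identically zero. -/
open MeasureTheory

/-- If `u : ℝ → ℝ` solves the ODE `u' = arctan(t)·u` on all of `ℝ` and
`t ↦ u(t)²` is Lebesgue-integrable, then `u` is identically zero. -/
theorem growing_ode_solution_vanishes
    (u : ℝ → ℝ)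
    (hderiv : ∀ t : ℝ, HasDerivAt u (Real.arctan t * u t) t)
    (hint : Integrable (fun t : ℝ => (u t) ^ 2)) :
    ∀ t : ℝ, u t = 0 := by
  have hg : ∀ t : ℝ, HasDerivAt (fun t => (u t) ^ 2) (2 * Real.arctan t * (u t) ^ 2) t := by
    intro t
    have h := (hderiv t).pow 2
    have e : 2 * Real.arctan t * (u t) ^ 2
        = ((2 : ℕ) : ℝ) * u t ^ (2 - 1) * (Real.arctan t * u t) := by
      norm_num
      ring
    rw [e]
    exact h
  have hc : Continuous (fun t => (u t) ^ 2) :=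
    continuous_iff_continuousAt.2 fun t => (hg t).continuousAt
  have key : ∀ (t : ℝ) (S : Set ℝ), MeasurableSet S → volume S = ⊤ →
      (∀ s ∈ S, (u t) ^ 2 ≤ (u s) ^ 2) → u t = 0 := by
    intro t S hS hv hle
    have h1 : IntegrableOn (fun _ : ℝ => (u t) ^ 2) S := by
      refine Integrable.mono' (g := fun s => (u s) ^ 2) hint.integrableOn
        aestronglyMeasurable_const ?_
      filter_upwards [ae_restrict_mem hS] with s hs
      rw [Real.norm_of_nonneg (sq_nonneg _)]
      exact hle s hs
    rw [integrableOn_const_iff] at h1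
    simpa [hv] using h1
  intro t
  rcases le_total 0 t with ht | ht
  · have hm : MonotoneOn (fun t => (u t) ^ 2) (Set.Ici 0) := by
      apply monotoneOn_of_deriv_nonneg (convex_Ici 0) hc.continuousOn
        (fun x _ => (hg x).differentiableAt.differentiableWithinAt)
      intro x hx
      rw [interior_Ici] at hx
      rw [(hg x).deriv]
      have := Real.arctan_nonneg.2 (le_of_lt hx)
      positivity
    exact key t (Set.Ici t) measurableSet_Ici Real.volume_Ici
      fun s hs => hm ht (le_trans ht hs) hs
  · have hm : AntitoneOn (fun t => (u t) ^ 2) (Set.Iic 0) := by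
      apply antitoneOn_of_deriv_nonpos (convex_Iic 0) hc.continuousOn
        (fun x _ => (hg x).differentiableAt.differentiableWithinAt)
      intro x hx
      rw [interior_Iic] at hx
      rw [(hg x).deriv]
      have := Real.arctan_lt_zero.2 hx
      nlinarith [sq_nonneg (u x)]
    exact key t (Set.Iic t) measurableSet_Iic Real.volume_Iic
      fun s hs => hm (le_trans hs ht) ht hs
end
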